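/- Suppose the binary relation ≻ on F satisfies Axioms 1–7. Then for all f ∈ F and x, y, z ∈ X: if f ⋈ x, f ≻ y and z ≻ f, then z ≻ x and x ≻ y. -/

import Mathlib

/-!
Framework: Anscombe–Aumann acts, finitely additive probability measures,
simple acts, hope-and-prepare preferences (Bastianello–Hill style setup).
-/

open Set

section Framework

variable (S : Type*) [MeasurableSpace S]

/-- The measurable sets (events) of `S`, as a subtype. -/
abbrev MSet := {A : Set S // MeasurableSet A}

/-- Finitely additive probability measures on `(S, Σ)`, viewed as real-valued
set functions on events.  The weak* topology is the topology of pointwise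
convergence on events, i.e. the product topology on `MSet S → ℝ`. -/
def ProbCharges : Set (MSet S → ℝ) :=
  {p | (∀ A, 0 ≤ p A) ∧ p ⟨Set.univ, MeasurableSet.univ⟩ = 1 ∧
    ∀ A B : MSet S, Disjoint A.1 B.1 → p ⟨A.1 ∪ B.1, A.2.union B.2⟩ = p A + p B}

end Framework

section Fns

variable {S : Type*} [MeasurableSpace S]

/-- `φ : S → ℝ` is a measurable simple function (an element of `B₀(Σ)`). -/
def IsSimpleFn (φ : S → ℝ) : Prop :=
  (Set.range φ).Finite ∧ ∀ y : ℝ, MeasurableSet (φ ⁻¹' {y})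

/-- The integral `∫ φ dp` of a simple function `φ` against a finitely additive
measure `p` (junk value `0` if `φ` is not simple). -/
noncomputable def fInt (p : MSet S → ℝ) (φ : S → ℝ) : ℝ :=
  @dite _ (IsSimpleFn φ) (Classical.dec _)
    (fun h => ∑ y ∈ h.1.toFinset, y * p ⟨φ ⁻¹' {y}, h.2 y⟩) (fun _ => 0)

/-- A functional `I : B₀(Σ) → ℝ` is monotonic. -/
def MonotonicFn (I : (S → ℝ) → ℝ) : Prop :=
  ∀ φ ψ, IsSimpleFn φ → IsSimpleFn ψ → (∀ s, φ s ≤ ψ s) → I φ ≤ I ψ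

/-- A functional `I : B₀(Σ) → ℝ` is constant-linear: `I(aφ + b) = a I(φ) + b`
for `a ≥ 0`, `b ∈ ℝ`. -/
def ConstLinearFn (I : (S → ℝ) → ℝ) : Prop :=
  ∀ φ, IsSimpleFn φ → ∀ a : ℝ, 0 ≤ a → ∀ b : ℝ,
    I (fun s => a * φ s + b) = a * I φ + b

end Fns

section Acts

variable {S : Type*} [MeasurableSpace S] {V : Type*} [AddCommGroup V] [Module ℝ V]

/-- `f : S → V` is a simple act with outcomes in `X`: it is `X`-valued,
takes finitely many values and is `Σ`-measurable. -/
def IsAct (X : Set V) (f : S → V) : Prop :=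
  (∀ s, f s ∈ X) ∧ (Set.range f).Finite ∧ ∀ v : V, MeasurableSet (f ⁻¹' {v})

/-- Pointwise mixture `αf + (1-α)g` of two acts. -/
def mixAct (α : ℝ) (f g : S → V) : S → V := fun s => α • f s + (1 - α) • g s

/-- The constant act with outcome `x`. -/
def constAct (S : Type*) {V : Type*} (x : V) : S → V := fun _ => x

/-- `u : V → ℝ` is affine on the convex set `X`. -/
def IsAffineOn (u : V → ℝ) (X : Set V) : Prop :=
  ∀ x ∈ X, ∀ y ∈ X, ∀ α : ℝ, 0 ≤ α → α ≤ 1 →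
    u (α • x + (1 - α) • y) = α * u x + (1 - α) * u y

/-- `u` is non-constant on `X`. -/
def NonConstOn (u : V → ℝ) (X : Set V) : Prop := ∃ x ∈ X, ∃ y ∈ X, u x ≠ u y

/-- Expected utility `∫ u(f) dp` of the act `f` under the measure `p`. -/
noncomputable def EU (u : V → ℝ) (f : S → V) (p : MSet S → ℝ) : ℝ :=
  fInt p (fun s => u (f s))

/-- Worst-case expected utility of `f` over the set of scenarios `C`. -/
noncomputable def minEU (u : V → ℝ) (C : Set (MSet S → ℝ)) (f : S → V) : ℝ :=
  sInf (EU u f '' C)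

/-- Best-case expected utility of `f` over the set of scenarios `D`. -/
noncomputable def maxEU (u : V → ℝ) (D : Set (MSet S → ℝ)) (f : S → V) : ℝ :=
  sSup (EU u f '' D)

/-- `f` and `g` are incomparable (`f ⋈ g`). -/
def Incomp (R : (S → V) → (S → V) → Prop) (f g : S → V) : Prop := ¬ R f g ∧ ¬ R g f

end Acts

section Axioms

variable {S : Type*} [MeasurableSpace S] {V : Type*} [AddCommGroup V] [Module ℝ V]
variable (X : Set V) (R : (S → V) → (S → V) → Prop)

/-- Axiom 1: `≻` is asymmetric and transitive on acts, and its restriction to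
constant acts is non-trivial and negatively transitive. -/
def PrefAx1 : Prop :=
  (∀ f g, IsAct X f → IsAct X g → R f g → ¬ R g f) ∧
  (∀ f g h, IsAct X f → IsAct X g → IsAct X h → R f g → R g h → R f h) ∧
  (∃ x ∈ X, ∃ y ∈ X, R (constAct S x) (constAct S y)) ∧
  (∀ x ∈ X, ∀ y ∈ X, ∀ z ∈ X, ¬ R (constAct S x) (constAct S y) →
    ¬ R (constAct S y) (constAct S z) → ¬ R (constAct S x) (constAct S z))

/-- Axiom 2 (continuity). -/
def PrefAx2 : Prop :=
  ∀ f g h, IsAct X f → IsAct X g → IsAct X h →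
    IsOpen {α : Set.Icc (0 : ℝ) 1 | R (mixAct (α : ℝ) f g) h} ∧
    IsOpen {α : Set.Icc (0 : ℝ) 1 | R h (mixAct (α : ℝ) f g)}

/-- Axiom 3 (certainty independence). -/
def PrefAx3 : Prop :=
  ∀ f g, IsAct X f → IsAct X g → ∀ x ∈ X, ∀ α : ℝ, 0 < α → α < 1 →
    (R f g ↔ R (mixAct α f (constAct S x)) (mixAct α g (constAct S x)))

/-- Axiom 4: for any outcome `x`, the upper and lower contour sets at the
constant act `x` are convex. -/
def PrefAx4 : Prop :=
  ∀ x ∈ X,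
    (∀ f g, IsAct X f → IsAct X g → R f (constAct S x) → R g (constAct S x) →
      ∀ α : ℝ, 0 ≤ α → α ≤ 1 → R (mixAct α f g) (constAct S x)) ∧
    (∀ f g, IsAct X f → IsAct X g → R (constAct S x) f → R (constAct S x) g →
      ∀ α : ℝ, 0 ≤ α → α ≤ 1 → R (constAct S x) (mixAct α f g))

/-- Axiom 5 (monotonicity). -/
def PrefAx5 : Prop :=
  ∀ f g, IsAct X f → IsAct X g →
    (∀ s : S, R (constAct S (f s)) (constAct S (g s))) → R f g

/-- Axiom 6: if every outcome incomparable to `f` is incomparable to `g`,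
then `f` and `g` are incomparable. -/
def PrefAx6 : Prop :=
  ∀ f g, IsAct X f → IsAct X g →
    (∀ x ∈ X, Incomp R f (constAct S x) → Incomp R g (constAct S x)) → Incomp R f g

/-- Axiom 7: if `f ⋈ x`, `x ≻ g`, `g ⋈ y` and `f ≻ y`, then `f ≻ g`. -/
def PrefAx7 : Prop :=
  ∀ f g, IsAct X f → IsAct X g → ∀ x ∈ X, ∀ y ∈ X,
    Incomp R f (constAct S x) → R (constAct S x) g →
    Incomp R g (constAct S y) → R f (constAct S y) → R f g

end Axioms

section Reps

variable {S : Type*} [MeasurableSpace S] {V : Type*} [AddCommGroup V] [Module ℝ V]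

/-- `(u, C, D)` is a hope-and-prepare representation of `R`. -/
def IsHPRep (X : Set V) (R : (S → V) → (S → V) → Prop) (u : V → ℝ)
    (C D : Set (MSet S → ℝ)) : Prop :=
  IsAffineOn u X ∧ NonConstOn u X ∧
  C.Nonempty ∧ D.Nonempty ∧ C ⊆ ProbCharges S ∧ D ⊆ ProbCharges S ∧
  IsCompact C ∧ IsCompact D ∧ Convex ℝ C ∧ Convex ℝ D ∧ (C ∩ D).Nonempty ∧
  ∀ f g, IsAct X f → IsAct X g →
    (R f g ↔ (minEU u C g < minEU u C f ∧ maxEU u D g < maxEU u D f))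

/-- `(u, C)` is a Bewley representation of `R`. -/
def IsBewleyRep (X : Set V) (R : (S → V) → (S → V) → Prop) (u : V → ℝ)
    (C : Set (MSet S → ℝ)) : Prop :=
  IsAffineOn u X ∧ NonConstOn u X ∧
  C.Nonempty ∧ C ⊆ ProbCharges S ∧ IsCompact C ∧ Convex ℝ C ∧
  ∀ f g, IsAct X f → IsAct X g → (R f g ↔ ∀ p ∈ C, EU u g p < EU u f p)

/-- `(u, C, D)` is a twofold multi-prior representation of `R`. -/
def IsTwofoldRep (X : Set V) (R : (S → V) → (S → V) → Prop) (u : V → ℝ)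
    (C D : Set (MSet S → ℝ)) : Prop :=
  IsAffineOn u X ∧ NonConstOn u X ∧
  C.Nonempty ∧ D.Nonempty ∧ C ⊆ ProbCharges S ∧ D ⊆ ProbCharges S ∧
  IsCompact C ∧ IsCompact D ∧ Convex ℝ C ∧ Convex ℝ D ∧ (C ∩ D).Nonempty ∧
  ∀ f g, IsAct X f → IsAct X g → (R f g ↔ maxEU u D g < minEU u C f)

end Reps

/-- An open subset of the unit interval containing `0` contains an interior point. -/
lemma exists_mem_Ioo_of_isOpen_unitInterval {P : ℝ → Prop}
    (hP : IsOpen {α : Set.Icc (0 : ℝ) 1 | P α}) (h0 : P 0) :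
    ∃ α : ℝ, 0 < α ∧ α < 1 ∧ P α := by
  obtain ⟨ε, hε, hball⟩ := Metric.isOpen_iff.1 hP ⟨0, by simp⟩ h0
  have hpos : 0 < min (ε / 2) (1 / 2) := by positivity
  have hle : min (ε / 2) (1 / 2) ≤ ε / 2 := min_le_left _ _
  have hhalf : min (ε / 2) (1 / 2) ≤ 1 / 2 := min_le_right _ _
  refine ⟨min (ε / 2) (1 / 2), hpos, by linarith, ?_⟩
  refine @hball ⟨min (ε / 2) (1 / 2), hpos.le, by linarith⟩ ?_
  rw [Metric.mem_ball, Subtype.dist_eq, Real.dist_eq, sub_zero, abs_of_pos hpos]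
  linarith

section ConstantActs

lemma isAct_constAct {S V : Type*} [MeasurableSpace S] {X : Set V} {x : V} (hx : x ∈ X) : IsAct X (constAct S x) :=
  ⟨fun _ => hx, Set.finite_range_const, fun v => MeasurableSet.const (x = v)⟩

variable {S : Type*} {V : Type*} [AddCommGroup V] [Module ℝ V]

lemma mixAct_constAct (α : ℝ) (x y : V) :
    mixAct α (constAct S x) (constAct S y) = constAct S (α • x + (1 - α) • y) := rfl

lemma mixAct_zero (f g : S → V) : mixAct 0 f g = g := by
  funext s
  simp [mixAct]

lemma mixAct_self (α : ℝ) (f : S → V) : mixAct α f f = f := by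
  funext s
  simp [mixAct, ← add_smul]

end ConstantActs

section Statement

variable {S : Type*} [MeasurableSpace S] [Nonempty S]
variable {V : Type*} [AddCommGroup V] [Module ℝ V]

/-- Lemma 1: under Axioms 1–7, if `f ⋈ x`, `f ≻ y` and
`z ≻ f`, then `z ≻ x` and `x ≻ y`. -/
theorem statement10 (X : Set V) (hX : Convex ℝ X) (hX2 : ∃ x ∈ X, ∃ y ∈ X, x ≠ y)
    (R : (S → V) → (S → V) → Prop)
    (hax : PrefAx1 X R ∧ PrefAx2 X R ∧ PrefAx3 X R ∧ PrefAx4 X R ∧ PrefAx5 X R ∧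
      PrefAx6 X R ∧ PrefAx7 X R)
    (f : S → V) (hf : IsAct X f) (x y z : V) (hx : x ∈ X) (hy : y ∈ X) (hz : z ∈ X)
    (h1 : Incomp R f (constAct S x)) (h2 : R f (constAct S y))
    (h3 : R (constAct S z) f) :
    R (constAct S z) (constAct S x) ∧ R (constAct S x) (constAct S y) := by
  obtain ⟨⟨_, htrans, _, hneg⟩, hcont, hind, _⟩ := hax
  have hcx := isAct_constAct (S := S) hx
  have hcy := isAct_constAct (S := S) hy
  have hcz := isAct_constAct (S := S) hz
  have hzy : R (constAct S z) (constAct S y) := htrans _ _ _ hcz hf hcy h3 h2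
  constructor
  · by_contra hzx
    obtain ⟨α, hα0, hα1, hαf⟩ := exists_mem_Ioo_of_isOpen_unitInterval
      (P := fun α => R (mixAct α (constAct S y) (constAct S z)) f)
      (hcont _ _ f hcy hcz hf).1 (by rwa [mixAct_zero])
    have hmix := (hind _ _ hcz hcy z hz α hα0 hα1).1 hzy
    rw [mixAct_self] at hmix
    rw [mixAct_constAct] at hαf hmix
    have hw : α • y + (1 - α) • z ∈ X := hX hy hz hα0.le (by linarith) (by ring)
    have hxw : R (constAct S x) (constAct S (α • y + (1 - α) • z)) := by
      by_contra hxw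
      exact hneg z hz x hx _ hw hzx hxw hmix
    exact h1.2 (htrans _ _ _ hcx (isAct_constAct hw) hf hxw hαf)
  · by_contra hxy
    obtain ⟨α, hα0, hα1, hαf⟩ := exists_mem_Ioo_of_isOpen_unitInterval
      (P := fun α => R f (mixAct α (constAct S z) (constAct S y)))
      (hcont _ _ f hcz hcy hf).2 (by rwa [mixAct_zero])
    have hmix := (hind _ _ hcz hcy y hy α hα0 hα1).1 hzy
    rw [mixAct_self] at hmix
    rw [mixAct_constAct] at hαf hmix
    have hw : α • z + (1 - α) • y ∈ X := hX hz hy hα0.le (by linarith) (by ring)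
    have hwx : R (constAct S (α • z + (1 - α) • y)) (constAct S x) := by
      by_contra hwx
      exact hneg _ hw x hx y hy hwx hxy hmix
    exact h1.1 (htrans _ _ _ hf (isAct_constAct hw) hcx hαf hwx)

end Statement
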